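/- arXiv:1503.01139 — 7 statements merged into one kernel-verified Lean document; each statement's English description precedes it below -/
import Mathlib

section
/- Let (U, 𝒜, α) be a measure space, (V, ℬ, β) a probability space, w : I → ℝ a continuous injection, and H : U × V → I a function such that for every x ∈ U the function w ∘ H_x is β-integrable, where H_x : V → ℝ, y ↦ H(x,y). Then the function φ : U → ℝ, x ↦ M_β^w(H_x) is well-defined and φ[U] ⊆ I. Moreover, if H is (𝒜 ⊗ ℬ)-measurable and w ∘ H is bounded, then φ is 𝒜-measurable. -/
open MeasureTheory Set Function

/-- The integral of a function with values in an order-connected set, with respect to a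
probability measure, lies in that set. -/
theorem Set.OrdConnected.integral_mem {V : Type*} [MeasurableSpace V] {β : Measure V}
    [IsProbabilityMeasure β] {J : Set ℝ} (hJ : J.OrdConnected) {f : V → ℝ}
    (hf : Integrable f β) (hfJ : ∀ y, f y ∈ J) : ∫ y, f y ∂β ∈ J := by
  obtain ⟨a, ha⟩ := exists_le_integral hf
  obtain ⟨b, hb⟩ := exists_integral_le hf
  exact hJ.out (hfJ a) (hfJ b) ⟨ha, hb⟩

/-- A function into a measurable set `I` is measurable as soon as its composition with a map
that is continuous and injective on `I` is. -/
theorem ContinuousOn.measurable_of_comp_of_injOn {U : Type*} [MeasurableSpace U] {I : Set ℝ}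
    (hI : MeasurableSet I) {w : ℝ → ℝ} (hwc : ContinuousOn w I) (hwi : InjOn w I)
    {φ : U → ℝ} (hφ : ∀ x, φ x ∈ I) (h : Measurable fun x => w (φ x)) : Measurable φ := by
  have := hI.standardBorel
  have hw : MeasurableEmbedding (I.domRestrict w) :=
    hwc.domRestrict.measurable.measurableEmbedding (injOn_iff_injective.1 hwi)
  have hcod : Measurable fun x => (⟨φ x, hφ x⟩ : I) := hw.measurable_comp_iff.1 h
  exact measurable_subtype_coe.comp hcod

/-- **Proposition 2(i).** Let `(U, 𝒜, α)` be a measure space, `(V, ℬ, β)` a probability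
space, `w : I → ℝ` a continuous injection, and `H : U × V → I` such that for every
`x ∈ U` the function `w ∘ H_x` is `β`-integrable.  Then `φ : U → ℝ, x ↦ M_β^w(H_x)` is
well-defined (the inner integral lies in `w[I]`) and `φ[U] ⊆ I`.  Moreover, if `H` is
`(𝒜 ⊗ ℬ)`-measurable and `w ∘ H` is bounded, then `φ` is `𝒜`-measurable.
Here `w⁻¹` (the inverse of the corestriction of `w` to `w[I]`) is `Function.invFunOn w I`. -/
theorem mean_section_welldefined_and_measurable
    {U V : Type*} [MeasurableSpace U] [MeasurableSpace V]
    (α : Measure U) (β : Measure V) [IsProbabilityMeasure β]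
    (I : Set ℝ) (hI : I.Nonempty) (hIconn : I.OrdConnected)
    (w : ℝ → ℝ) (hwc : ContinuousOn w I) (hwi : Set.InjOn w I)
    (H : U × V → ℝ) (hH : ∀ p, H p ∈ I)
    (hint : ∀ x, Integrable (fun y => w (H (x, y))) β) :
    (∀ x, (∫ y, w (H (x, y)) ∂β) ∈ w '' I) ∧
      (∀ x, Function.invFunOn w I (∫ y, w (H (x, y)) ∂β) ∈ I) ∧
      (Measurable H → (∃ C, ∀ p, |w (H p)| ≤ C) →
        Measurable fun x => Function.invFunOn w I (∫ y, w (H (x, y)) ∂β)) := by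
  have hmem : ∀ x, (∫ y, w (H (x, y)) ∂β) ∈ w '' I := fun x =>
    (hIconn.isPreconnected.image w hwc).ordConnected.integral_mem (hint x)
      fun y => mem_image_of_mem w (hH (x, y))
  refine ⟨hmem, fun x => invFunOn_mem (hmem x), fun hHm _ => ?_⟩
  refine hwc.measurable_of_comp_of_injOn hIconn.measurableSet hwi
    (fun x => invFunOn_mem (hmem x)) ?_
  simp only [invFunOn_eq (hmem _)]
  have hwH : Measurable fun p => w (H p) :=
    hwc.domRestrict.measurable.comp (hHm.subtype_mk (h := hH))
  exact hwH.stronglyMeasurable.integral_prod_right'.measurable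
end

section
/- Let (U, 𝒜, α) be a measure space, (V, ℬ, β) a probability space, w : I → ℝ a continuous injection, and H : U × V → I an (𝒜 ⊗ ℬ)-measurable function such that H[U × V] is contained in a compact subset of I. Then the function φ : U → ℝ, x ↦ M_β^w(H_x) (where H_x : V → ℝ, y ↦ H(x,y)) is well-defined, satisfies φ[U] ⊆ I, and is 𝒜-measurable and bounded; in fact φ[U] is contained in a compact subset of I. -/
open MeasureTheory Set Function

/-- The composition of a function continuous on `[a, b]` with a measurable function valued in
`[a, b]` is measurable. -/
theorem measurable_comp_of_continuousOn_Icc {S : Type*} [MeasurableSpace S] {a b : ℝ}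
    {w : ℝ → ℝ} (hw : ContinuousOn w (Icc a b)) {f : S → ℝ} (hf : Measurable f)
    (hfJ : ∀ s, f s ∈ Icc a b) : Measurable (w ∘ f) :=
  hw.domRestrict.measurable.comp (hf.subtype_mk (h := hfJ))

/-- The integral of `w ∘ f` against a probability measure lies in `w '' [a, b]` if `w` is
continuous on `[a, b]` and `f` is measurable with values in `[a, b]`. -/
theorem integral_comp_mem_image_Icc {S : Type*} [MeasurableSpace S] (β : Measure S)
    [IsProbabilityMeasure β] {a b : ℝ} {w : ℝ → ℝ} (hw : ContinuousOn w (Icc a b))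
    {f : S → ℝ} (hf : Measurable f) (hfJ : ∀ s, f s ∈ Icc a b) :
    ∫ s, (w ∘ f) s ∂β ∈ w '' Icc a b := by
  have hcpt : IsCompact (w '' Icc a b) := isCompact_Icc.image_of_continuousOn hw
  have hmem : ∀ s, (w ∘ f) s ∈ w '' Icc a b := fun s => mem_image_of_mem w (hfJ s)
  obtain ⟨C, hC⟩ := hcpt.isBounded.exists_norm_le
  have hint : Integrable (w ∘ f) β :=
    .of_bound (measurable_comp_of_continuousOn_Icc hw hf hfJ).aestronglyMeasurable C
      (.of_forall fun s => hC _ (hmem s))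
  exact (isPreconnected_Icc.image w hw).ordConnected.convex.integral_mem hcpt.isClosed
    (.of_forall hmem) hint

/-- **Proposition 2(ii).** Let `(U, 𝒜, α)` be a measure space, `(V, ℬ, β)` a probability
space, `w : I → ℝ` a continuous injection, and `H : U × V → I` an `(𝒜 ⊗ ℬ)`-measurable
function whose image is contained in a compact subset of `I`.  Then
`φ : U → ℝ, x ↦ M_β^w(H_x)` is well-defined, `φ[U] ⊆ I`, `φ` is `𝒜`-measurable and
bounded; in fact `φ[U]` is contained in a compact subset of `I`. -/
theorem mean_section_measurable_and_bounded
    {U V : Type*} [MeasurableSpace U] [MeasurableSpace V]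
    (α : Measure U) (β : Measure V) [IsProbabilityMeasure β]
    (I : Set ℝ) (hI : I.Nonempty) (hIconn : I.OrdConnected)
    (w : ℝ → ℝ) (hwc : ContinuousOn w I) (hwi : Set.InjOn w I)
    (H : U × V → ℝ) (hHmeas : Measurable H)
    (hHK : ∃ K : Set ℝ, IsCompact K ∧ K ⊆ I ∧ Set.range H ⊆ K) :
    (∀ x, (∫ y, w (H (x, y)) ∂β) ∈ w '' I) ∧
      (∀ x, Function.invFunOn w I (∫ y, w (H (x, y)) ∂β) ∈ I) ∧
      (Measurable fun x => Function.invFunOn w I (∫ y, w (H (x, y)) ∂β)) ∧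
      (∃ K' : Set ℝ, IsCompact K' ∧ K' ⊆ I ∧
        Set.range (fun x => Function.invFunOn w I (∫ y, w (H (x, y)) ∂β)) ⊆ K') := by
  rcases isEmpty_or_nonempty U with hU | ⟨⟨x₀⟩⟩
  · exact ⟨isEmptyElim, isEmptyElim, measurable_of_empty _, ∅, isCompact_empty,
      empty_subset _, range_subset_iff.2 isEmptyElim⟩
  obtain ⟨K, hKc, hKI, hHK⟩ := hHK
  obtain ⟨y₀⟩ : Nonempty V := nonempty_of_isProbabilityMeasure β
  have hKne : K.Nonempty := ⟨_, hHK (mem_range_self (x₀, y₀))⟩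
  have hJI : Icc (sInf K) (sSup K) ⊆ I :=
    hIconn.out (hKI (hKc.sInf_mem hKne)) (hKI (hKc.sSup_mem hKne))
  have hHJ : ∀ p, H p ∈ Icc (sInf K) (sSup K) := fun p =>
    ⟨csInf_le hKc.bddBelow (hHK (mem_range_self p)),
      le_csSup hKc.bddAbove (hHK (mem_range_self p))⟩
  have hmem := fun x => integral_comp_mem_image_Icc β (hwc.mono hJI)
    (hHmeas.comp measurable_prodMk_left) (fun y => hHJ (x, y))
  have hinv : ∀ x, invFunOn w I (∫ y, w (H (x, y)) ∂β) ∈ Icc (sInf K) (sSup K) ∧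
      w (invFunOn w I (∫ y, w (H (x, y)) ∂β)) = ∫ y, w (H (x, y)) ∂β := by
    intro x
    obtain ⟨j, hj, hjx⟩ := hmem x
    simp only [comp_apply] at hjx
    rw [← hjx, hwi.leftInvOn_invFunOn (hJI hj)]
    exact ⟨hj, rfl⟩
  refine ⟨fun x => image_mono hJI (hmem x), fun x => hJI (hinv x).1, ?_,
    Icc (sInf K) (sSup K), isCompact_Icc, hJI, range_subset_iff.2 fun x => (hinv x).1⟩
  have hemb : MeasurableEmbedding ((Icc (sInf K) (sSup K)).domRestrict w) :=
    ((hwc.mono hJI).domRestrict.isClosedEmbedding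
      (injOn_iff_injective.1 (hwi.mono hJI))).measurableEmbedding
  have hwH := measurable_comp_of_continuousOn_Icc (hwc.mono hJI) hHmeas hHJ
  have hint : Measurable fun x => ∫ y, w (H (x, y)) ∂β :=
    hwH.stronglyMeasurable.integral_prod_right'.measurable
  have hsub : Measurable fun x => (⟨_, (hinv x).1⟩ : Icc (sInf K) (sSup K)) :=
    hemb.measurable_comp_iff.1 (by
      convert hint using 1
      exact funext fun x => (hinv x).2)
  exact measurable_subtype_coe.comp hsub
end

section
/- Let (X, ℒ, λ) and (Y, ℳ, μ) be probability spaces and f, g : I → ℝ continuous injections. If there exist a, b ∈ ℝ with a ≠ 0 such that f = a·g + b, then (f, g) is a (λ, μ)-switch. -/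
open MeasureTheory Set Function

/-- For probability spaces `(X, ℒ, λ)` and `(Y, ℳ, μ)` and functions `f, g : ℝ → ℝ`
(thought of as continuous injections on the interval `I`), the pair `(f, g)` is a
`(λ, μ)`-switch if for every `(ℒ ⊗ ℳ)`-measurable `h : X × Y → I` whose image is
contained in a compact subset of `I`, it holds that
`f⁻¹(∫_X f(g⁻¹(∫_Y g(h(x,y)) dμ(y))) dλ(x)) = g⁻¹(∫_Y g(f⁻¹(∫_X f(h(x,y)) dλ(x))) dμ(y))`,
where `f⁻¹` — the inverse of the corestriction of `f` to `f[I]` — is rendered as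
`Function.invFunOn f I`, and similarly for `g⁻¹`. -/
def IsSwitch {X Y : Type*} [MeasurableSpace X] [MeasurableSpace Y]
    (lam : Measure X) (mu : Measure Y) (I : Set ℝ) (f g : ℝ → ℝ) : Prop :=
  ∀ h : X × Y → ℝ, Measurable h →
    (∃ K : Set ℝ, IsCompact K ∧ K ⊆ I ∧ Set.range h ⊆ K) →
    Function.invFunOn f I
        (∫ x, f (Function.invFunOn g I (∫ y, g (h (x, y)) ∂mu)) ∂lam)
      = Function.invFunOn g I
          (∫ y, g (Function.invFunOn f I (∫ x, f (h (x, y)) ∂lam)) ∂mu)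

theorem integral_mem_Icc_of_forall_mem {Z : Type*} [MeasurableSpace Z] (nu : Measure Z)
    [IsProbabilityMeasure nu] {u : Z → ℝ} {m M : ℝ} (hu : Integrable u nu)
    (hb : ∀ z, u z ∈ Icc m M) : ∫ z, u z ∂nu ∈ Icc m M :=
  (convex_Icc m M).integral_mem isClosed_Icc (Filter.Eventually.of_forall hb) hu

theorem integrable_of_forall_mem_Icc {Z : Type*} [MeasurableSpace Z] (nu : Measure Z)
    [IsFiniteMeasure nu] {u : Z → ℝ} {m M : ℝ} (hu : Measurable u)
    (hb : ∀ z, u z ∈ Icc m M) : Integrable u nu :=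
  Integrable.of_mem_Icc m M hu.aemeasurable (Filter.Eventually.of_forall hb)

theorem ContinuousOn.measurable_comp_of_forall_mem {Z : Type*} [MeasurableSpace Z]
    {g : ℝ → ℝ} {K : Set ℝ} (hg : ContinuousOn g K) {h : Z → ℝ} (hh : Measurable h)
    (hK : ∀ z, h z ∈ K) : Measurable fun z => g (h z) :=
  (continuousOn_iff_continuous_domRestrict.mp hg).measurable.comp (hh.subtype_mk (h := hK))

/-- **Sufficiency.** Let `(X, ℒ, λ)` and `(Y, ℳ, μ)` be probability spaces and
`f, g : I → ℝ` continuous injections.  If there exist `a, b ∈ ℝ` with `a ≠ 0` such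
that `f = a·g + b` (on `I`), then `(f, g)` is a `(λ, μ)`-switch. -/
theorem isSwitch_of_affine {X Y : Type*} [MeasurableSpace X] [MeasurableSpace Y]
    (lam : Measure X) (mu : Measure Y)
    [IsProbabilityMeasure lam] [IsProbabilityMeasure mu]
    (I : Set ℝ) (hI : I.Nonempty) (hIconn : I.OrdConnected)
    (f g : ℝ → ℝ) (hfc : ContinuousOn f I) (hfi : Set.InjOn f I)
    (hgc : ContinuousOn g I) (hgi : Set.InjOn g I)
    (haff : ∃ a b : ℝ, a ≠ 0 ∧ ∀ x ∈ I, f x = a * g x + b) :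
    IsSwitch lam mu I f g := by
  obtain ⟨a, b, ha, hab⟩ := haff
  rintro h hh ⟨K, hK, hKI, hhK⟩
  have hmem : ∀ p, h p ∈ K := fun p => hhK (mem_range_self p)
  obtain ⟨x₀⟩ := nonempty_of_isProbabilityMeasure lam
  obtain ⟨y₀⟩ := nonempty_of_isProbabilityMeasure mu
  have hKne : K.Nonempty := ⟨_, hmem (x₀, y₀)⟩
  have hgK := hgc.mono hKI
  obtain ⟨k₁, hk₁, hmin⟩ := hK.exists_isMinOn hKne hgK
  obtain ⟨k₂, hk₂, hmax⟩ := hK.exists_isMaxOn hKne hgK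
  have hIcc : Icc (g k₁) (g k₂) ⊆ g '' I :=
    (hIconn.isPreconnected.image g hgc).Icc_subset
      (mem_image_of_mem g (hKI hk₁)) (mem_image_of_mem g (hKI hk₂))
  have hb : ∀ p, g (h p) ∈ Icc (g k₁) (g k₂) := fun p => ⟨hmin (hmem p), hmax (hmem p)⟩
  have hmeas : Measurable fun p => g (h p) := hgK.measurable_comp_of_forall_mem hh hmem
  have hint : Integrable (fun p => g (h p)) (lam.prod mu) :=
    integrable_of_forall_mem_Icc _ hmeas hb
  have hintY : ∀ x, Integrable (fun y => g (h (x, y))) mu := fun x =>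
    integrable_of_forall_mem_Icc _ (hmeas.comp measurable_prodMk_left) fun y => hb (x, y)
  have hintX : ∀ y, Integrable (fun x => g (h (x, y))) lam := fun y =>
    integrable_of_forall_mem_Icc _ (hmeas.comp measurable_prodMk_right) fun x => hb (x, y)
  have hY : ∀ x, ∫ y, g (h (x, y)) ∂mu ∈ Icc (g k₁) (g k₂) := fun x =>
    integral_mem_Icc_of_forall_mem mu (hintY x) fun y => hb (x, y)
  have hX : ∀ y, ∫ x, g (h (x, y)) ∂lam ∈ Icc (g k₁) (g k₂) := fun y =>
    integral_mem_Icc_of_forall_mem lam (hintX y) fun x => hb (x, y)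
  have hS : ∫ x, ∫ y, g (h (x, y)) ∂mu ∂lam ∈ g '' I :=
    hIcc (integral_mem_Icc_of_forall_mem lam hint.integral_prod_left hY)
  have invFunOn_affine : ∀ s ∈ g '' I, invFunOn f I (a * s + b) = invFunOn g I s := by
    rintro _ ⟨r, hr, rfl⟩
    rw [hgi.leftInvOn_invFunOn hr, ← hab r hr, hfi.leftInvOn_invFunOn hr]
  have hleft : ∀ x, f (invFunOn g I (∫ y, g (h (x, y)) ∂mu))
      = a * ∫ y, g (h (x, y)) ∂mu + b := fun x => by
    rw [hab _ (invFunOn_mem (hIcc (hY x))), invFunOn_eq (hIcc (hY x))]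
  have hright : ∀ y, g (invFunOn f I (∫ x, f (h (x, y)) ∂lam))
      = ∫ x, g (h (x, y)) ∂lam := fun y => by
    have hf : ∫ x, f (h (x, y)) ∂lam = a * ∫ x, g (h (x, y)) ∂lam + b := by
      simp_rw [fun x => hab _ (hKI (hmem (x, y)))]
      rw [integral_add ((hintX y).const_mul a) (integrable_const b), integral_const_mul]
      simp
    rw [hf, invFunOn_affine _ (hIcc (hX y)), invFunOn_eq (hIcc (hX y))]
  simp_rw [hleft, hright]
  rw [integral_add (hint.integral_prod_left.const_mul a) (integrable_const b),
    integral_const_mul, ← integral_integral_swap (f := fun x y => g (h (x, y))) hint]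
  simpa using invFunOn_affine _ hS
end

section
/- Let (X, ℒ, λ) and (Y, ℳ, μ) be probability spaces with λ and μ non-degenerate, and suppose f, g : I → ℝ are continuous injections such that (f, g) is a (λ, μ)-switch. Then there exist λ₁, μ₁ ∈ ]0,1[ such that for all a, b, c, d ∈ I, f⁻¹(λ₁ f(g⁻¹(μ₁ g(a) + (1−μ₁) g(c))) + (1−λ₁) f(g⁻¹(μ₁ g(b) + (1−μ₁) g(d)))) = g⁻¹(μ₁ g(f⁻¹(λ₁ f(a) + (1−λ₁) f(b))) + (1−μ₁) g(f⁻¹(λ₁ f(c) + (1−λ₁) f(d)))), i.e. (f, g) is a discrete (λ′, μ′)-switch for the probability measures λ′, μ′ on the powerset of {0,1} given by λ′({0}) = λ₁ and μ′({0}) = μ₁. -/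
open MeasureTheory Set Function

/-- The integral against a probability measure of a function taking one value on a measurable
set and another value off it. -/
theorem integral_ite_const {X : Type*} [MeasurableSpace X] (lam : Measure X)
    [IsProbabilityMeasure lam] {E : Set X} (hE : MeasurableSet E)
    [DecidablePred (· ∈ E)] (p q : ℝ) :
    ∫ x, (if x ∈ E then p else q) ∂lam = lam.real E * p + (1 - lam.real E) * q := by
  change ∫ x, E.piecewise (fun _ => p) (fun _ => q) x ∂lam = _
  rw [integral_piecewise hE integrableOn_const integrableOn_const]
  simp [probReal_compl_eq_one_sub hE]

theorem measureReal_mem_Ioo {X : Type*} [MeasurableSpace X] (lam : Measure X)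
    [IsProbabilityMeasure lam] {E : Set X} (h0 : 0 < lam E) (h1 : lam E < 1) :
    lam.real E ∈ Set.Ioo (0 : ℝ) 1 :=
  ⟨ENNReal.toReal_pos h0.ne' (measure_ne_top _ _),
    by simpa [Measure.real] using (ENNReal.toReal_lt_toReal (measure_ne_top _ _) (by simp)).2 h1⟩

/-- **Reduction to the discrete case.** Let `(X, ℒ, λ)` and `(Y, ℳ, μ)` be probability
spaces with `λ` and `μ` non-degenerate, and suppose the continuous injections
`f, g : I → ℝ` form a `(λ, μ)`-switch.  Then there exist `λ₁, μ₁ ∈ ]0,1[` such that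
for all `a, b, c, d ∈ I`,
`f⁻¹(λ₁ f(g⁻¹(μ₁ g a + (1−μ₁) g c)) + (1−λ₁) f(g⁻¹(μ₁ g b + (1−μ₁) g d)))
  = g⁻¹(μ₁ g(f⁻¹(λ₁ f a + (1−λ₁) f b)) + (1−μ₁) g(f⁻¹(λ₁ f c + (1−λ₁) f d)))`,
i.e. `(f, g)` is a discrete `(λ′, μ′)`-switch for the probability measures `λ′, μ′` on
the powerset of `{0, 1}` determined by `λ′({0}) = λ₁` and `μ′({0}) = μ₁`. -/
theorem isSwitch_discrete_reduction {X Y : Type*} [MeasurableSpace X] [MeasurableSpace Y]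
    (lam : Measure X) (mu : Measure Y)
    [IsProbabilityMeasure lam] [IsProbabilityMeasure mu]
    (hlam : ∃ E, MeasurableSet E ∧ 0 < lam E ∧ lam E < 1)
    (hmu : ∃ F, MeasurableSet F ∧ 0 < mu F ∧ mu F < 1)
    (I : Set ℝ) (hI : I.Nonempty) (hIconn : I.OrdConnected)
    (f g : ℝ → ℝ) (hfc : ContinuousOn f I) (hfi : Set.InjOn f I)
    (hgc : ContinuousOn g I) (hgi : Set.InjOn g I)
    (hswitch : IsSwitch lam mu I f g) :
    ∃ l m : ℝ, l ∈ Set.Ioo (0 : ℝ) 1 ∧ m ∈ Set.Ioo (0 : ℝ) 1 ∧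
      ∀ a ∈ I, ∀ b ∈ I, ∀ c ∈ I, ∀ d ∈ I,
        Function.invFunOn f I
            (l * f (Function.invFunOn g I (m * g a + (1 - m) * g c))
              + (1 - l) * f (Function.invFunOn g I (m * g b + (1 - m) * g d)))
          = Function.invFunOn g I
              (m * g (Function.invFunOn f I (l * f a + (1 - l) * f b))
                + (1 - m) * g (Function.invFunOn f I (l * f c + (1 - l) * f d))) := by
  classical
  obtain ⟨E, hE, hE0, hE1⟩ := hlam
  obtain ⟨F, hF, hF0, hF1⟩ := hmu
  refine ⟨lam.real E, mu.real F, measureReal_mem_Ioo lam hE0 hE1,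
    measureReal_mem_Ioo mu hF0 hF1, fun a ha b hb c hc d hd => ?_⟩
  let h : X × Y → ℝ := fun z =>
    if z.1 ∈ E then (if z.2 ∈ F then a else c) else (if z.2 ∈ F then b else d)
  have hE' : MeasurableSet {z : X × Y | z.1 ∈ E} := measurable_fst hE
  have hF' : MeasurableSet {z : X × Y | z.2 ∈ F} := measurable_snd hF
  have hm : Measurable h :=
    Measurable.ite hE' (Measurable.ite hF' measurable_const measurable_const)
      (Measurable.ite hF' measurable_const measurable_const)
  have hK : ∃ K : Set ℝ, IsCompact K ∧ K ⊆ I ∧ Set.range h ⊆ K := by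
    refine ⟨{a, b, c, d}, (Set.toFinite _).isCompact, ?_, ?_⟩
    · rintro x (rfl | rfl | rfl | rfl) <;> assumption
    · rintro _ ⟨z, rfl⟩
      dsimp only [h]
      split_ifs <;> simp
  have hy : ∀ x, ∫ y, g (h (x, y)) ∂mu =
      if x ∈ E then mu.real F * g a + (1 - mu.real F) * g c
      else mu.real F * g b + (1 - mu.real F) * g d := fun x => by
    by_cases hx : x ∈ E <;> simp only [h, hx, if_true, if_false, apply_ite g,
      integral_ite_const mu hF]
  have hx : ∀ y, ∫ x, f (h (x, y)) ∂lam =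
      if y ∈ F then lam.real E * f a + (1 - lam.real E) * f b
      else lam.real E * f c + (1 - lam.real E) * f d := fun y => by
    by_cases hy : y ∈ F <;> simp only [h, hy, if_true, if_false, apply_ite f,
      integral_ite_const lam hE]
  have key := hswitch h hm hK
  simp only [hy, hx, apply_ite (Function.invFunOn g I), apply_ite (Function.invFunOn f I),
    apply_ite f, apply_ite g, integral_ite_const lam hE, integral_ite_const mu hF] at key
  exact key
end

section
/- Let V be a vector space over ℝ (or over ℂ), D ⊆ V a convex set, and κ ∈ ]0,1[. If Φ : D → ℝ is κ-affine, i.e. Φ(κ v₁ + (1−κ) v₂) = κ Φ(v₁) + (1−κ) Φ(v₂) for all v₁, v₂ ∈ D, then Φ is Jensen-affine, i.e. Φ((v₁ + v₂)/2) = (Φ(v₁) + Φ(v₂))/2 for all v₁, v₂ ∈ D. -/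
open Set

/-- **κ-affinity implies Jensen-affinity.** Let `V` be a vector space over `ℝ` (any
complex vector space is in particular a real one), `D ⊆ V` a convex set, and
`κ ∈ ]0,1[`.  If `Φ : D → ℝ` is `κ`-affine, i.e.
`Φ(κ v₁ + (1−κ) v₂) = κ Φ(v₁) + (1−κ) Φ(v₂)` for all `v₁, v₂ ∈ D`, then `Φ` is
Jensen-affine: `Φ((v₁ + v₂)/2) = (Φ(v₁) + Φ(v₂))/2` for all `v₁, v₂ ∈ D`. -/
theorem kappa_affine_implies_jensen_affine {V : Type*} [AddCommGroup V] [Module ℝ V]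
    (D : Set V) (hD : Convex ℝ D) (κ : ℝ) (hκ : κ ∈ Set.Ioo (0 : ℝ) 1)
    (Φ : V → ℝ)
    (hΦ : ∀ v₁ ∈ D, ∀ v₂ ∈ D,
      Φ (κ • v₁ + (1 - κ) • v₂) = κ * Φ v₁ + (1 - κ) * Φ v₂) :
    ∀ v₁ ∈ D, ∀ v₂ ∈ D, Φ ((2⁻¹ : ℝ) • (v₁ + v₂)) = (Φ v₁ + Φ v₂) / 2 := by
  intro x hx y hy
  obtain ⟨h0, h1⟩ := hκ
  have hκ' : 0 < 1 - κ := sub_pos.2 h1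
  set m : V := (2⁻¹ : ℝ) • (x + y) with hm
  have hmD : m ∈ D := by
    rw [hm, smul_add]
    exact hD hx hy (by norm_num) (by norm_num) (by norm_num)
  have hp : κ • m + (1 - κ) • x ∈ D := hD hmD hx h0.le hκ'.le (by ring)
  have hq : κ • y + (1 - κ) • m ∈ D := hD hy hmD h0.le hκ'.le (by ring)
  -- The Daróczy–Páles identity
  have hid : κ • (κ • m + (1 - κ) • x) + (1 - κ) • (κ • y + (1 - κ) • m) = m := by
    rw [hm]
    module
  have key := hΦ _ hp _ hq
  rw [hid, hΦ m hmD x hx, hΦ y hy m hmD] at key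
  have hne : κ * (1 - κ) ≠ 0 := (mul_pos h0 hκ').ne'
  apply mul_left_cancel₀ hne
  linear_combination key / 2
end

section
/- Fix α, β ∈ ]0,1[ and let φ : [0,1] → [0,1] be a continuous bijection with φ(0) = 0 and φ(1) = 1 such that for all s, t, u, v ∈ [0,1], φ(α φ⁻¹(β s + (1−β) t) + (1−α) φ⁻¹(β u + (1−β) v)) = β φ(α φ⁻¹(s) + (1−α) φ⁻¹(u)) + (1−β) φ(α φ⁻¹(t) + (1−α) φ⁻¹(v)). Then there exists A ∈ ]0,1[ such that φ(α u + (1−α) v) = A φ(u) + (1−A) φ(v) for all u, v ∈ [0,1]. -/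
open Set Function

/-- A continuous function on `[0,1]` that respects convex combinations with weight `β` and vanishes
at both endpoints is nonpositive. -/
lemma nonpos_of_weighted_affine {β : ℝ} (hβ : β ∈ Ioo (0 : ℝ) 1) {f : ℝ → ℝ}
    (hc : ContinuousOn f (Icc 0 1))
    (hf : ∀ s ∈ Icc (0 : ℝ) 1, ∀ t ∈ Icc (0 : ℝ) 1,
      f (β * s + (1 - β) * t) = β * f s + (1 - β) * f t)
    (h0 : f 0 = 0) (h1 : f 1 = 0) {x : ℝ} (hx : x ∈ Icc (0 : ℝ) 1) : f x ≤ 0 := by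
  obtain ⟨m, hm, hmax⟩ := isCompact_Icc.exists_isMaxOn ⟨x, hx⟩ hc
  have hle : ∀ y ∈ Icc (0 : ℝ) 1, f y ≤ f m := fun y hy => hmax hy
  have hK : IsCompact (Icc (0 : ℝ) 1 ∩ f ⁻¹' {f m}) :=
    isCompact_Icc.of_isClosed_subset
      (hc.preimage_isClosed_of_isClosed isClosed_Icc isClosed_singleton) inter_subset_left
  obtain ⟨a, ⟨ha, hfa⟩, hleast⟩ := hK.exists_isLeast ⟨m, hm, rfl⟩
  replace hfa : f a = f m := hfa
  rcases ha.1.eq_or_lt with rfl | ha0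
  · linarith [hle x hx]
  rcases ha.2.eq_or_lt with rfl | ha1
  · linarith [hle x hx]
  exfalso
  obtain ⟨hβ0, hβ1⟩ := hβ
  obtain ⟨d, hd, hda, hdb⟩ : ∃ d : ℝ, 0 < d ∧ d ≤ a ∧ d ≤ 1 - a :=
    ⟨min a (1 - a), lt_min ha0 (by linarith), min_le_left _ _, min_le_right _ _⟩
  have hs : a - (1 - β) * d ∈ Icc (0 : ℝ) 1 := ⟨by nlinarith, by nlinarith⟩
  have ht : a + β * d ∈ Icc (0 : ℝ) 1 := ⟨by nlinarith, by nlinarith⟩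
  have key := hf _ hs _ ht
  rw [show β * (a - (1 - β) * d) + (1 - β) * (a + β * d) = a by ring] at key
  have hlt : f (a - (1 - β) * d) < f m := by
    refine (hle _ hs).lt_of_ne fun h => ?_
    have := hleast ⟨hs, h⟩
    nlinarith
  nlinarith [hle _ ht]

/-- A continuous function on `[0,1]` that respects convex combinations with weight `β` is affine. -/
lemma eq_of_weighted_affine {β : ℝ} (hβ : β ∈ Ioo (0 : ℝ) 1) {f : ℝ → ℝ}
    (hc : ContinuousOn f (Icc 0 1))
    (hf : ∀ s ∈ Icc (0 : ℝ) 1, ∀ t ∈ Icc (0 : ℝ) 1,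
      f (β * s + (1 - β) * t) = β * f s + (1 - β) * f t)
    (h0 : f 0 = 0) {x : ℝ} (hx : x ∈ Icc (0 : ℝ) 1) : f x = x * f 1 := by
  have hu := nonpos_of_weighted_affine hβ (f := fun y => f y - y * f 1) (by fun_prop)
    (fun s hs t ht => by simp only [hf s hs t ht]; ring) (by simp [h0]) (by simp) hx
  have hl := nonpos_of_weighted_affine hβ (f := fun y => y * f 1 - f y) (by fun_prop)
    (fun s hs t ht => by simp only [hf s hs t ht]; ring) (by simp [h0]) (by simp) hx
  linarith

lemma continuousOn_invFunOn_of_isCompact {X Y : Type*} [TopologicalSpace X] [Nonempty X]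
    [TopologicalSpace Y] [T2Space Y] {f : X → Y} {s : Set X} {t : Set Y} (hs : IsCompact s)
    (hc : ContinuousOn f s) (hb : BijOn f s t) : ContinuousOn (invFunOn f s) t := by
  have hinv := hb.invOn_invFunOn
  rw [continuousOn_iff_isClosed]
  intro C hC
  refine ⟨f '' (s ∩ C), ((hs.inter_right hC).image_of_continuousOn
    (hc.mono inter_subset_left)).isClosed, ?_⟩
  ext y
  constructor
  · rintro ⟨hyC, hy⟩
    exact ⟨⟨_, ⟨invFunOn_mem (hb.surjOn hy), hyC⟩, hinv.2 hy⟩, hy⟩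
  · rintro ⟨⟨x, ⟨hx, hxC⟩, rfl⟩, hy⟩
    exact ⟨by simpa only [mem_preimage, hinv.1 hx] using hxC, hy⟩

/-- A function on the unit square that respects convex combinations with weight `β`, is continuous
along the rays from the origin and vanishes there, is linear. -/
lemma eq_of_weighted_affine_square {β : ℝ} (hβ : β ∈ Ioo (0 : ℝ) 1) {g : ℝ → ℝ → ℝ}
    (hc : ∀ s ∈ Icc (0 : ℝ) 1, ∀ u ∈ Icc (0 : ℝ) 1,
      ContinuousOn (fun r => g (r * s) (r * u)) (Icc 0 1))
    (hg : ∀ s ∈ Icc (0 : ℝ) 1, ∀ t ∈ Icc (0 : ℝ) 1, ∀ u ∈ Icc (0 : ℝ) 1, ∀ v ∈ Icc (0 : ℝ) 1,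
      g (β * s + (1 - β) * t) (β * u + (1 - β) * v) = β * g s u + (1 - β) * g t v)
    (h0 : g 0 0 = 0) {s u : ℝ} (hs : s ∈ Icc (0 : ℝ) 1) (hu : u ∈ Icc (0 : ℝ) 1) :
    g s u = s * g 1 0 + u * g 0 1 := by
  have hz : (0 : ℝ) ∈ Icc (0 : ℝ) 1 := ⟨le_rfl, zero_le_one⟩
  have ho : (1 : ℝ) ∈ Icc (0 : ℝ) 1 := ⟨zero_le_one, le_rfl⟩
  have ray : ∀ s ∈ Icc (0 : ℝ) 1, ∀ u ∈ Icc (0 : ℝ) 1, ∀ r ∈ Icc (0 : ℝ) 1,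
      g (r * s) (r * u) = r * g s u := by
    intro s hs u hu r hr
    have := eq_of_weighted_affine hβ (hc s hs u hu) (fun p hp q hq => ?_) (by simp [h0]) hr
    · simpa using this
    · rw [← hg _ (unitInterval.mul_mem hp hs) _ (unitInterval.mul_mem hq hs)
        _ (unitInterval.mul_mem hp hu) _ (unitInterval.mul_mem hq hu)]
      congr 1 <;> ring
  have hβ' : β ∈ Icc (0 : ℝ) 1 := ⟨hβ.1.le, hβ.2.le⟩
  have hβ'' : 1 - β ∈ Icc (0 : ℝ) 1 := ⟨by linarith [hβ.2], by linarith [hβ.1]⟩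
  have hx := unitInterval.mul_mem hβ'' hs
  have hy := unitInterval.mul_mem hβ' hu
  have e := hg _ hx _ hz _ hz _ hy
  have e1 := ray 1 ho 0 hz _ hx
  have e2 := ray 0 hz 1 ho _ hy
  have e3 := ray s hs u hu _ (unitInterval.mul_mem hβ' hβ'')
  simp only [mul_zero, mul_one, add_zero, zero_add] at e e1 e2
  rw [e1, e2, show β * ((1 - β) * s) = β * (1 - β) * s by ring,
    show (1 - β) * (β * u) = β * (1 - β) * u by ring, e3] at e
  have hpos : 0 < β * (1 - β) := mul_pos hβ.1 (by linarith [hβ.2])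
  apply mul_left_cancel₀ hpos.ne'
  linarith

/-- Fix `α, β ∈ ]0,1[` and let `φ : [0,1] → [0,1]` be a continuous bijection with
`φ(0) = 0` and `φ(1) = 1` such that for all `s, t, u, v ∈ [0,1]`,
`φ(α φ⁻¹(β s + (1−β) t) + (1−α) φ⁻¹(β u + (1−β) v))
  = β φ(α φ⁻¹(s) + (1−α) φ⁻¹(u)) + (1−β) φ(α φ⁻¹(t) + (1−α) φ⁻¹(v))`.
Then there exists `A ∈ ]0,1[` such that `φ(α u + (1−α) v) = A φ(u) + (1−A) φ(v)`
for all `u, v ∈ [0,1]`, i.e. `φ` is `(α, A)`-affine.  Here `φ⁻¹` — the inverse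
of the bijection `φ : [0,1] → [0,1]` — is rendered as `Function.invFunOn φ (Icc 0 1)`. -/
theorem exists_A_affine (α β : ℝ) (hα : α ∈ Set.Ioo (0 : ℝ) 1) (hβ : β ∈ Set.Ioo (0 : ℝ) 1)
    (φ : ℝ → ℝ) (hφc : ContinuousOn φ (Set.Icc 0 1))
    (hφbij : Set.BijOn φ (Set.Icc 0 1) (Set.Icc 0 1))
    (hφ0 : φ 0 = 0) (hφ1 : φ 1 = 1)
    (heq : ∀ s ∈ Set.Icc (0 : ℝ) 1, ∀ t ∈ Set.Icc (0 : ℝ) 1,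
      ∀ u ∈ Set.Icc (0 : ℝ) 1, ∀ v ∈ Set.Icc (0 : ℝ) 1,
      φ (α * Function.invFunOn φ (Set.Icc 0 1) (β * s + (1 - β) * t)
          + (1 - α) * Function.invFunOn φ (Set.Icc 0 1) (β * u + (1 - β) * v))
        = β * φ (α * Function.invFunOn φ (Set.Icc 0 1) s
            + (1 - α) * Function.invFunOn φ (Set.Icc 0 1) u)
          + (1 - β) * φ (α * Function.invFunOn φ (Set.Icc 0 1) t
              + (1 - α) * Function.invFunOn φ (Set.Icc 0 1) v)) :
    ∃ A ∈ Set.Ioo (0 : ℝ) 1, ∀ u ∈ Set.Icc (0 : ℝ) 1, ∀ v ∈ Set.Icc (0 : ℝ) 1,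
      φ (α * u + (1 - α) * v) = A * φ u + (1 - A) * φ v := by
  have hz : (0 : ℝ) ∈ Icc (0 : ℝ) 1 := ⟨le_rfl, zero_le_one⟩
  have ho : (1 : ℝ) ∈ Icc (0 : ℝ) 1 := ⟨zero_le_one, le_rfl⟩
  have hψc := continuousOn_invFunOn_of_isCompact isCompact_Icc hφc hφbij
  have hψm : ∀ y ∈ Icc (0 : ℝ) 1, invFunOn φ (Icc 0 1) y ∈ Icc (0 : ℝ) 1 :=
    fun y hy => invFunOn_mem (hφbij.surjOn hy)
  have hψφ : ∀ x ∈ Icc (0 : ℝ) 1, invFunOn φ (Icc 0 1) (φ x) = x :=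
    fun x hx => hφbij.invOn_invFunOn.1 hx
  generalize invFunOn φ (Icc 0 1) = ψ at *
  have hψ0 : ψ 0 = 0 := by simpa [hφ0] using hψφ 0 hz
  have hψ1 : ψ 1 = 1 := by simpa [hφ1] using hψφ 1 ho
  have hcomb : ∀ x ∈ Icc (0 : ℝ) 1, ∀ y ∈ Icc (0 : ℝ) 1,
      α * x + (1 - α) * y ∈ Icc (0 : ℝ) 1 := fun x hx y hy =>
    convex_Icc 0 1 hx hy hα.1.le (sub_nonneg.2 hα.2.le) (add_sub_cancel _ _)
  have hray : ∀ s ∈ Icc (0 : ℝ) 1, ContinuousOn (fun r => ψ (r * s)) (Icc 0 1) := fun s hs =>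
    hψc.comp (by fun_prop) fun r hr => unitInterval.mul_mem hr hs
  have lin : ∀ s ∈ Icc (0 : ℝ) 1, ∀ u ∈ Icc (0 : ℝ) 1,
      φ (α * ψ s + (1 - α) * ψ u) = s * φ α + u * φ (1 - α) := by
    intro s hs u hu
    have := eq_of_weighted_affine_square hβ (g := fun s u => φ (α * ψ s + (1 - α) * ψ u))
      (fun s hs u hu => hφc.comp
        ((continuousOn_const.mul (hray s hs)).add (continuousOn_const.mul (hray u hu)))
        fun r hr => hcomb _ (hψm _ (unitInterval.mul_mem hr hs)) _
          (hψm _ (unitInterval.mul_mem hr hu)))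
      heq (by simp [hψ0, hφ0]) hs hu
    simpa [hψ0, hψ1] using this
  have hsum : φ (1 - α) = 1 - φ α := by
    have := lin 1 ho 1 ho
    simp only [hψ1, mul_one, add_sub_cancel, hφ1, one_mul] at this
    linarith
  have hαm : α ∈ Icc (0 : ℝ) 1 := ⟨hα.1.le, hα.2.le⟩
  have hA := hφbij.mapsTo hαm
  refine ⟨φ α, ⟨hA.1.lt_of_ne fun h => ?_, hA.2.lt_of_ne fun h => ?_⟩, fun u hu v hv => ?_⟩
  · exact hα.1.ne (hφbij.injOn hz hαm (hφ0.trans h))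
  · exact hα.2.ne (hφbij.injOn hαm ho (h.trans hφ1.symm))
  · have := lin _ (hφbij.mapsTo hu) _ (hφbij.mapsTo hv)
    rw [hψφ u hu, hψφ v hv, hsum] at this
    rw [this]
    ring
end

section
/- Fix α, β ∈ ]0,1[ and let f, g : I → ℝ be continuous injections such that for all x, y, z, w ∈ I, f⁻¹(α f(g⁻¹(β g(x) + (1−β) g(y))) + (1−α) f(g⁻¹(β g(z) + (1−β) g(w)))) = g⁻¹(β g(f⁻¹(α f(x) + (1−α) f(z))) + (1−β) g(f⁻¹(α f(y) + (1−α) f(w)))). Then there exist a, b ∈ ℝ with a ≠ 0 such that f = a·g + b. -/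
open Set Function

/-- A map into a compact set `K` is continuous as soon as its composition with a continuous
function that is injective on `K` is continuous. -/
lemma ContinuousOn.of_comp_injOn_isCompact {k g : ℝ → ℝ} {S K : Set ℝ} (hK : IsCompact K)
    (hg : ContinuousOn g K) (hgi : InjOn g K) (hk : MapsTo k S K)
    (hgk : ContinuousOn (fun x => g (k x)) S) : ContinuousOn k S := by
  have : CompactSpace K := isCompact_iff_compactSpace.mp hK
  have hemb : Topology.IsClosedEmbedding (K.domRestrict g) :=
    (continuousOn_iff_continuous_domRestrict.mp hg).isClosedEmbedding (injOn_iff_injective.mp hgi)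
  have hc : Continuous (hk.restrict k S K) := by
    rw [hemb.isInducing.continuous_iff]
    exact continuousOn_iff_continuous_domRestrict.mp hgk
  rw [continuousOn_iff_continuous_domRestrict]
  exact continuous_subtype_val.comp hc

/-- A continuous midpoint-affine function vanishing at the endpoints of an interval is
nonpositive on it. -/
lemma nonpos_of_midpoint_of_endpoints {d : ℝ → ℝ} {p q : ℝ} (hd : ContinuousOn d (Icc p q))
    (hmid : ∀ x ∈ Icc p q, ∀ y ∈ Icc p q, d ((x + y) / 2) = (d x + d y) / 2)
    (hp : d p = 0) (hq : d q = 0) : ∀ x ∈ Icc p q, d x ≤ 0 := by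
  intro x hx
  obtain ⟨m, hm, hmax⟩ := isCompact_Icc.exists_isMaxOn ⟨x, hx⟩ hd
  refine (hmax hx).trans ?_
  by_contra! hpos
  have hS : IsCompact (Icc p q ∩ d ⁻¹' {d m}) :=
    isCompact_Icc.of_isClosed_subset (hd.preimage_isClosed_of_isClosed isClosed_Icc
      isClosed_singleton) inter_subset_left
  obtain ⟨c, ⟨hc, hcm⟩, hleast⟩ := hS.exists_isLeast ⟨m, hm, rfl⟩
  have hcm : d c = d m := hcm
  have hpc : p < c := lt_of_le_of_ne hc.1 (by rintro rfl; linarith)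
  have hcq : c < q := lt_of_le_of_ne hc.2 (by rintro rfl; linarith)
  obtain ⟨e, he, hep, heq⟩ : ∃ e, 0 < e ∧ e ≤ c - p ∧ e ≤ q - c :=
    ⟨min (c - p) (q - c), lt_min (by linarith) (by linarith), min_le_left _ _, min_le_right _ _⟩
  have ha : c - e ∈ Icc p q := ⟨by linarith, by linarith⟩
  have hb : c + e ∈ Icc p q := ⟨by linarith, by linarith⟩
  have h := hmid _ ha _ hb
  rw [show (c - e + (c + e)) / 2 = c by ring] at h
  have hma : d (c - e) ≤ d m := hmax ha
  have hmb : d (c + e) ≤ d m := hmax hb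
  have : c ≤ c - e := hleast ⟨ha, show d (c - e) = d m by linarith⟩
  linarith

/-- A continuous midpoint-affine function on a compact interval is affine. -/
lemma affine_of_midpoint {h : ℝ → ℝ} {p q : ℝ} (hh : ContinuousOn h (Icc p q))
    (hmid : ∀ x ∈ Icc p q, ∀ y ∈ Icc p q, h ((x + y) / 2) = (h x + h y) / 2) :
    ∀ x ∈ Icc p q, (h x - h p) * (q - p) = (h q - h p) * (x - p) := by
  intro x hx
  have h₁ := nonpos_of_midpoint_of_endpoints
    (d := fun x => (h x - h p) * (q - p) - (h q - h p) * (x - p)) (p := p) (q := q)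
    (by fun_prop) (fun x hx y hy => by simp only [hmid x hx y hy]; ring) (by simp)
    (by ring) x hx
  have h₂ := nonpos_of_midpoint_of_endpoints
    (d := fun x => (h q - h p) * (x - p) - (h x - h p) * (q - p)) (p := p) (q := q)
    (by fun_prop) (fun x hx y hy => by simp only [hmid x hx y hy]; ring) (by simp)
    (by ring) x hx
  linarith

lemma convexComb_mem_Icc {p q s x y : ℝ} (hs : s ∈ Icc (0 : ℝ) 1) (hx : x ∈ Icc p q)
    (hy : y ∈ Icc p q) : s * x + (1 - s) * y ∈ Icc p q :=
  convex_Icc p q hx hy hs.1 (sub_nonneg.mpr hs.2) (by ring)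

/-- Weighted affinity implies midpoint affinity (the Daróczy–Páles identity), for a function of
two variables. -/
lemma midpoint_of_weighted {F : ℝ → ℝ → ℝ} {p q s t : ℝ} (hs : s ∈ Icc (0 : ℝ) 1)
    (ht : t ∈ Ioo (0 : ℝ) 1)
    (hF : ∀ x ∈ Icc p q, ∀ y ∈ Icc p q, ∀ z ∈ Icc p q, ∀ w ∈ Icc p q,
      F (s * x + (1 - s) * y) (s * z + (1 - s) * w) = t * F x z + (1 - t) * F y w) :
    ∀ x ∈ Icc p q, ∀ y ∈ Icc p q, ∀ z ∈ Icc p q, ∀ w ∈ Icc p q,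
      F ((x + y) / 2) ((z + w) / 2) = (F x z + F y w) / 2 := by
  intro x hx y hy z hz w hw
  have hm : ∀ {x y : ℝ}, x ∈ Icc p q → y ∈ Icc p q → (x + y) / 2 ∈ Icc p q := fun hx hy =>
    ⟨by linarith [hx.1, hy.1], by linarith [hx.2, hy.2]⟩
  have hmu := hm hx hy
  have hmv := hm hz hw
  have h := hF _ (convexComb_mem_Icc hs hmu hy) _ (convexComb_mem_Icc hs hx hmu)
    _ (convexComb_mem_Icc hs hmv hw) _ (convexComb_mem_Icc hs hz hmv)
  rw [hF _ hmu _ hy _ hmv _ hw, hF _ hx _ hmu _ hz _ hmv] at h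
  have key : ∀ x y : ℝ, s * (s * ((x + y) / 2) + (1 - s) * y)
      + (1 - s) * (s * x + (1 - s) * ((x + y) / 2)) = (x + y) / 2 := fun x y => by ring
  rw [key, key] at h
  have h0 : t * (1 - t) ≠ 0 := mul_ne_zero ht.1.ne' (sub_pos.mpr ht.2).ne'
  apply mul_left_cancel₀ h0
  linarith

/-- If the weighted quasi-arithmetic mean `F` generated by `φ` commutes with a weighted
arithmetic mean on a compact interval, then `φ` is affine there. -/
lemma affine_of_quasiArithmetic_switch {φ : ℝ → ℝ} {F : ℝ → ℝ → ℝ} {p q α β : ℝ} (hpq : p < q)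
    (hα : α ∈ Ioo (0 : ℝ) 1) (hβ : β ∈ Ioo (0 : ℝ) 1)
    (hφ : ContinuousOn φ (Icc p q)) (hφi : InjOn φ (Icc p q))
    (hFm : ∀ u ∈ Icc p q, ∀ v ∈ Icc p q, F u v ∈ Icc p q)
    (hFφ : ∀ u ∈ Icc p q, ∀ v ∈ Icc p q, φ (F u v) = α * φ u + (1 - α) * φ v)
    (hF : ∀ x ∈ Icc p q, ∀ y ∈ Icc p q, ∀ z ∈ Icc p q, ∀ w ∈ Icc p q,
      F (β * x + (1 - β) * y) (β * z + (1 - β) * w) = β * F x z + (1 - β) * F y w) :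
    ∀ x ∈ Icc p q, (φ x - φ p) * (q - p) = (φ q - φ p) * (x - p) := by
  have hmid := midpoint_of_weighted (Ioo_subset_Icc_self hβ) hβ hF
  have hp : p ∈ Icc p q := left_mem_Icc.mpr hpq.le
  have hq : q ∈ Icc p q := right_mem_Icc.mpr hpq.le
  have hdiag : ∀ u ∈ Icc p q, F u u = u := fun u hu =>
    hφi (hFm u hu u hu) hu (by rw [hFφ u hu u hu]; ring)
  have hcont : ContinuousOn (fun u => F u p) (Icc p q) :=
    .of_comp_injOn_isCompact isCompact_Icc hφ hφi (fun u hu => hFm u hu p hp)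
      ((by fun_prop : ContinuousOn (fun u => α * φ u + (1 - α) * φ p) (Icc p q)).congr
        fun u hu => hFφ u hu p hp)
  have haff := affine_of_midpoint hcont fun x hx y hy => by
    have h := hmid x hx y hy p hp p hp
    rwa [show (p + p) / 2 = p by ring] at h
  have hpq' : q - p ≠ 0 := (sub_pos.mpr hpq).ne'
  set s := (F q p - p) / (q - p) with hsdef
  have hs : s ∈ Icc (0 : ℝ) 1 := by
    have h := hFm q hq p hp
    exact ⟨div_nonneg (by linarith [h.1]) (by linarith),
      (div_le_one (by linarith)).mpr (by linarith [h.2])⟩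
  have hleft : ∀ u ∈ Icc p q, F u p = p + s * (u - p) := by
    intro u hu
    have h := haff u hu
    simp only [hdiag p hp] at h
    rw [hsdef]
    field_simp
    linarith
  have hFs : ∀ u ∈ Icc p q, ∀ v ∈ Icc p q, F u v = s * u + (1 - s) * v := by
    have hsplit : ∀ u ∈ Icc p q, ∀ v ∈ Icc p q, F u v = F u p + F p v - p := by
      intro u hu v hv
      have h₁ := hmid u hu p hp v hv p hp
      have h₂ := hmid u hu p hp p hp v hv
      rw [add_comm p v, h₁, hdiag p hp] at h₂
      linarith
    intro u hu v hv
    have h₁ := hsplit u hu v hv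
    have h₂ := hsplit v hv v hv
    rw [hdiag v hv, hleft v hv] at h₂
    rw [hleft u hu] at h₁
    linarith
  refine affine_of_midpoint hφ fun x hx y hy => ?_
  refine midpoint_of_weighted (F := fun u _ => φ u) hs hα ?_ x hx y hy x hx y hy
  intro x hx y hy _ _ _ _
  rw [← hFs x hx y hy, hFφ x hx y hy]

/-- Under the weighted switch equation, `f` is an affine function of `g` between any two points
of the interval. -/
lemma affine_between_of_weighted_switch {α β : ℝ}
    (hα : α ∈ Ioo (0 : ℝ) 1) (hβ : β ∈ Ioo (0 : ℝ) 1)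
    {I : Set ℝ} (hIconn : I.OrdConnected)
    {f g : ℝ → ℝ} (hfc : ContinuousOn f I) (hfi : InjOn f I)
    (hgc : ContinuousOn g I) (hgi : InjOn g I)
    (heq : ∀ x ∈ I, ∀ y ∈ I, ∀ z ∈ I, ∀ w ∈ I,
      invFunOn f I (α * f (invFunOn g I (β * g x + (1 - β) * g y))
            + (1 - α) * f (invFunOn g I (β * g z + (1 - β) * g w)))
        = invFunOn g I (β * g (invFunOn f I (α * f x + (1 - α) * f z))
              + (1 - β) * g (invFunOn f I (α * f y + (1 - α) * f w))))
    {a b : ℝ} (ha : a ∈ I) (hb : b ∈ I) (hab : g a < g b) :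
    ∀ x ∈ I, g x ∈ Icc (g a) (g b) →
      (f x - f a) * (g b - g a) = (f b - f a) * (g x - g a) := by
  have hKI : uIcc a b ⊆ I := hIconn.uIcc_subset ha hb
  have himg : Icc (g a) (g b) ⊆ g '' uIcc a b := by
    rw [← uIcc_of_le hab.le]
    exact intermediate_value_uIcc (hgc.mono hKI)
  have hinv : ∀ x ∈ I, invFunOn g I (g x) = x := fun x hx => hgi.leftInvOn_invFunOn hx
  have hfinv : ∀ x ∈ I, invFunOn f I (f x) = x := fun x hx => hfi.leftInvOn_invFunOn hx
  have hk : MapsTo (invFunOn g I) (Icc (g a) (g b)) (uIcc a b) := by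
    intro u hu
    obtain ⟨x, hx, rfl⟩ := himg hu
    rwa [hinv x (hKI hx)]
  have hgk : ∀ u ∈ Icc (g a) (g b), g (invFunOn g I u) = u := by
    intro u hu
    obtain ⟨x, hx, rfl⟩ := himg hu
    rw [hinv x (hKI hx)]
  have hkc : ContinuousOn (invFunOn g I) (Icc (g a) (g b)) :=
    .of_comp_injOn_isCompact isCompact_uIcc (hgc.mono hKI) (hgi.mono hKI) hk
      (continuousOn_id.congr hgk)
  have hkI : MapsTo (invFunOn g I) (Icc (g a) (g b)) I := fun u hu => hKI (hk hu)
  have hφ : ContinuousOn (fun u => f (invFunOn g I u)) (Icc (g a) (g b)) := hfc.comp hkc hkI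
  have hφi : InjOn (fun u => f (invFunOn g I u)) (Icc (g a) (g b)) := by
    intro u hu v hv huv
    rw [← hgk u hu, ← hgk v hv, hfi (hkI hu) (hkI hv) huv]
  have hF : ∀ u ∈ Icc (g a) (g b), ∀ v ∈ Icc (g a) (g b), ∃ t ∈ Icc (g a) (g b),
      f (invFunOn g I t) = α * f (invFunOn g I u) + (1 - α) * f (invFunOn g I v) ∧
      g (invFunOn f I (α * f (invFunOn g I u) + (1 - α) * f (invFunOn g I v))) = t := by
    intro u hu v hv
    have huv : uIcc u v ⊆ Icc (g a) (g b) := ordConnected_Icc.uIcc_subset hu hv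
    obtain ⟨t, ht, hte⟩ := intermediate_value_uIcc (hφ.mono huv)
      (convex_uIcc _ _ left_mem_uIcc right_mem_uIcc hα.1.le (sub_nonneg.mpr hα.2.le) (by ring))
    simp only [smul_eq_mul] at hte
    refine ⟨t, huv ht, hte, ?_⟩
    rw [← hte, hfinv _ (hkI (huv ht)), hgk t (huv ht)]
  have haff := affine_of_quasiArithmetic_switch
    (F := fun u v => g (invFunOn f I (α * f (invFunOn g I u) + (1 - α) * f (invFunOn g I v))))
    hab hα hβ hφ hφi
    (fun u hu v hv => by
      obtain ⟨t, ht, -, h⟩ := hF u hu v hv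
      simpa only [h] using ht)
    (fun u hu v hv => by
      obtain ⟨t, ht, h', h⟩ := hF u hu v hv
      simpa only [h] using h')
    (fun x hx y hy z hz w hw => by
      have h := congrArg g (heq _ (hkI hx) _ (hkI hy) _ (hkI hz) _ (hkI hw))
      rw [hgk x hx, hgk y hy, hgk z hz, hgk w hw] at h
      obtain ⟨t, ht, -, h₁⟩ := hF x hx z hz
      obtain ⟨r, hr, -, h₂⟩ := hF y hy w hw
      rw [h₁, h₂, hgk _ (convexComb_mem_Icc (Ioo_subset_Icc_self hβ) ht hr)] at h
      simp only [h₁, h₂]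
      exact h)
  intro x hx hxm
  have h := haff _ hxm
  simpa only [hinv x hx, hinv a ha, hinv b hb] using h

/-- **Lemma 3.** Fix `α, β ∈ ]0,1[` and let `f, g : I → ℝ` be continuous injections
(`I ⊆ ℝ` a nonempty interval) such that for all `x, y, z, w ∈ I`,
`f⁻¹(α f(g⁻¹(β g x + (1−β) g y)) + (1−α) f(g⁻¹(β g z + (1−β) g w)))
  = g⁻¹(β g(f⁻¹(α f x + (1−α) f z)) + (1−β) g(f⁻¹(α f y + (1−α) f w)))`,
i.e. `(f, g)` is an `(α; β)`-weighted switch.  Then there exist `a, b ∈ ℝ` with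
`a ≠ 0` such that `f = a·g + b` on `I`.  Here `f⁻¹`, the inverse of the corestriction
of `f` to `f[I]`, is rendered as `Function.invFunOn f I`, and similarly for `g⁻¹`. -/
theorem weighted_switch_implies_affine (α β : ℝ)
    (hα : α ∈ Set.Ioo (0 : ℝ) 1) (hβ : β ∈ Set.Ioo (0 : ℝ) 1)
    (I : Set ℝ) (hI : I.Nonempty) (hIconn : I.OrdConnected)
    (f g : ℝ → ℝ) (hfc : ContinuousOn f I) (hfi : Set.InjOn f I)
    (hgc : ContinuousOn g I) (hgi : Set.InjOn g I)
    (heq : ∀ x ∈ I, ∀ y ∈ I, ∀ z ∈ I, ∀ w ∈ I,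
      Function.invFunOn f I
          (α * f (Function.invFunOn g I (β * g x + (1 - β) * g y))
            + (1 - α) * f (Function.invFunOn g I (β * g z + (1 - β) * g w)))
        = Function.invFunOn g I
            (β * g (Function.invFunOn f I (α * f x + (1 - α) * f z))
              + (1 - β) * g (Function.invFunOn f I (α * f y + (1 - α) * f w)))) :
    ∃ a b : ℝ, a ≠ 0 ∧ ∀ x ∈ I, f x = a * g x + b := by
  rcases I.subsingleton_or_nontrivial with hs | ⟨x₀, hx₀, x₁, hx₁, hne⟩
  · obtain ⟨c, hc⟩ := hI
    refine ⟨1, f c - g c, one_ne_zero, fun x hx => ?_⟩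
    rw [hs hx hc]
    ring
  · have hg : g x₁ - g x₀ ≠ 0 := sub_ne_zero.mpr fun h => hne (hgi hx₁ hx₀ h).symm
    have hf : f x₁ - f x₀ ≠ 0 := sub_ne_zero.mpr fun h => hne (hfi hx₁ hx₀ h).symm
    refine ⟨(f x₁ - f x₀) / (g x₁ - g x₀), f x₀ - (f x₁ - f x₀) / (g x₁ - g x₀) * g x₀,
      div_ne_zero hf hg, fun x hx => ?_⟩
    have hT : ({x, x₀, x₁} : Set ℝ).Finite := by simp
    have hTI : ({x, x₀, x₁} : Set ℝ) ⊆ I := by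
      rintro y (rfl | rfl | rfl) <;> assumption
    obtain ⟨a, ha, hmin⟩ := exists_min_image _ g hT ⟨x, by simp⟩
    obtain ⟨b, hb, hmax⟩ := exists_max_image _ g hT ⟨x, by simp⟩
    have hm : ∀ y ∈ ({x, x₀, x₁} : Set ℝ), g y ∈ Icc (g a) (g b) := fun y hy =>
      ⟨hmin y hy, hmax y hy⟩
    have h0 := hm x₀ (by simp)
    have h1 := hm x₁ (by simp)
    have hab : g a < g b := by
      refine lt_of_le_of_ne (h0.1.trans h0.2) fun h => hg ?_
      linarith [h0.1, h0.2, h1.1, h1.2]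
    have haff := affine_between_of_weighted_switch hα hβ hIconn hfc hfi hgc hgi heq
      (hTI ha) (hTI hb) hab
    have e := haff x hx (hm x (by simp))
    have e0 := haff x₀ hx₀ h0
    have e1 := haff x₁ hx₁ h1
    have hpos : g b - g a ≠ 0 := (sub_pos.mpr hab).ne'
    have hslope : ∀ y, (f y - f a) * (g b - g a) = (f b - f a) * (g y - g a) →
        f y = f a + (f b - f a) / (g b - g a) * (g y - g a) := by
      intro y hy
      field_simp
      linarith
    rw [hslope x e, hslope x₀ e0, hslope x₁ e1]
    generalize (f b - f a) / (g b - g a) = k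
    field_simp
    ring
end
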